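/- arXiv:1902.07465 — 4 statements merged into one kernel-verified Lean document; each statement's English description precedes it below -/
import Mathlib

section
/- For every γ ∈ 𝕋^s, the orbit {γ^k : k ∈ ℕ} (with coordinate-wise powers) is a dense subset of T(γ); that is, the orbit is contained in T(γ) and its topological closure equals T(γ). -/
open Filter Topology Set

namespace UnitAddTorus

variable {d : Type*} [Fintype d]

lemma mFourier_add_right (v : d → ℤ) (x y : UnitAddTorus d) :
    mFourier v (x + y) = mFourier v x * mFourier v y := by
  simp [mFourier, fourier_apply, smul_add, AddCircle.toCircle_add, Finset.prod_mul_distrib]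

/-- Birkhoff averages of a nontrivial character along a rotation tend to zero. -/
lemma tendsto_birkhoffAverage_mFourier {v : d → ℤ} {g : UnitAddTorus d}
    (hv : mFourier v g ≠ 1) (x : UnitAddTorus d) :
    Tendsto (birkhoffAverage ℂ (g + ·) (mFourier v) · x) atTop (𝓝 0) := by
  have hb : Bornology.IsBounded (range (mFourier v)) :=
    (isCompact_range (mFourier v).continuous).isBounded
  have key := (tendsto_birkhoffAverage_apply_sub_birkhoffAverage' ℂ hb (g + ·) x).const_mul
    (mFourier v g - 1)⁻¹
  rw [mul_zero] at key
  refine key.congr fun n ↦ ?_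
  have hmul : birkhoffAverage ℂ (g + ·) (mFourier v) n (g + x) =
      mFourier v g * birkhoffAverage ℂ (g + ·) (mFourier v) n x := by
    simp only [birkhoffAverage, birkhoffSum, add_left_iterate, smul_eq_mul, Finset.mul_sum]
    refine Finset.sum_congr rfl fun k _ ↦ ?_
    simp only [mFourier_add_right]
    ring
  have := sub_ne_zero.mpr hv
  rw [hmul]
  field_simp

/-- The Birkhoff averages of a trigonometric polynomial along the orbits of `m` and of `0` under
the rotation by `g` are asymptotically equal when every character trivial at `g` is trivial
at `m`. -/
lemma tendsto_birkhoffAverage_sub_of_mem_span {g m : UnitAddTorus d}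
    (hgm : ∀ v : d → ℤ, mFourier v g = 1 → mFourier v m = 1) {p : C(UnitAddTorus d, ℂ)}
    (hp : p ∈ Submodule.span ℂ (range (mFourier (d := d)))) :
    Tendsto (fun n ↦ birkhoffAverage ℂ (g + ·) p n m - birkhoffAverage ℂ (g + ·) p n 0)
      atTop (𝓝 0) := by
  induction hp using Submodule.span_induction with
  | mem p hp =>
    obtain ⟨v, rfl⟩ := hp
    by_cases hv : mFourier v g = 1
    · refine tendsto_const_nhds.congr fun n ↦ ?_
      simp [birkhoffAverage, birkhoffSum, mFourier_add_right, hgm v hv]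
    · simpa using (tendsto_birkhoffAverage_mFourier hv m).sub
        (tendsto_birkhoffAverage_mFourier hv 0)
  | zero => simp [birkhoffAverage, birkhoffSum]
  | add p q _ _ hp hq =>
    have := hp.add hq
    rw [add_zero] at this
    refine this.congr fun n ↦ ?_
    simp only [birkhoffAverage, birkhoffSum, ContinuousMap.add_apply, Finset.sum_add_distrib,
      smul_eq_mul]
    ring
  | smul c p _ hp =>
    have := hp.const_mul c
    rw [mul_zero] at this
    refine this.congr fun n ↦ ?_
    simp only [birkhoffAverage, birkhoffSum, ContinuousMap.smul_apply, smul_eq_mul,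
      ← Finset.mul_sum]
    ring

lemma norm_birkhoffAverage_sub_le {X : Type*} [TopologicalSpace X] [CompactSpace X] (T : X → X)
    (p q : C(X, ℂ)) (n : ℕ) (x : X) :
    ‖birkhoffAverage ℂ T p n x - birkhoffAverage ℂ T q n x‖ ≤ ‖p - q‖ := by
  rw [birkhoffAverage, birkhoffAverage, ← smul_sub, birkhoffSum, birkhoffSum,
    ← Finset.sum_sub_distrib, norm_smul, norm_inv, Complex.norm_natCast]
  calc (n : ℝ)⁻¹ * ‖∑ k ∈ Finset.range n, (p (T^[k] x) - q (T^[k] x))‖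
      ≤ (n : ℝ)⁻¹ * (n * ‖p - q‖) := by
        gcongr
        refine (norm_sum_le_of_le _ fun k _ ↦ (p - q).norm_coe_le_norm _).trans_eq ?_
        simp
    _ ≤ ‖p - q‖ := by
        rcases eq_or_ne n 0 with rfl | hn
        · simp
        · field_simp
          rfl

/-- A continuous function invariant under the rotation by `g` is constant along `{0, m}` when every
character trivial at `g` is trivial at `m`. -/
lemma apply_eq_apply_zero_of_invariant {g m : UnitAddTorus d}
    (hgm : ∀ v : d → ℤ, mFourier v g = 1 → mFourier v m = 1) {f : C(UnitAddTorus d, ℂ)}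
    (hf : ∀ x, f (g + x) = f x) : f m = f 0 := by
  have havg (x : UnitAddTorus d) {n : ℕ} (hn : n ≠ 0) :
      birkhoffAverage ℂ (g + ·) f n x = f x := by
    have hk (k : ℕ) : f (k • g + x) = f x := by
      induction k with
      | zero => simp
      | succ k ih => rw [succ_nsmul', add_assoc, hf, ih]
    simp [birkhoffAverage, birkhoffSum, hk, hn]
  rw [← sub_eq_zero, ← norm_le_zero_iff]
  refine le_of_forall_pos_le_add fun ε hε ↦ ?_
  have hmem : f ∈ (Submodule.span ℂ (range (mFourier (d := d)))).topologicalClosure := by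
    rw [span_mFourier_closure_eq_top]
    trivial
  obtain ⟨p, hp, hfp⟩ := Metric.mem_closure_iff.mp hmem (ε / 2) (half_pos hε)
  rw [dist_eq_norm] at hfp
  have hlim := (tendsto_birkhoffAverage_sub_of_mem_span hgm hp).norm.add_const ε
  rw [norm_zero] at hlim
  refine ge_of_tendsto hlim ((eventually_ne_atTop 0).mono fun n hn ↦ ?_)
  have h1 := norm_birkhoffAverage_sub_le (g + ·) f p n m
  have h2 := norm_birkhoffAverage_sub_le (g + ·) f p n 0
  rw [havg _ hn] at h1 h2
  set a := birkhoffAverage ℂ (g + ·) p n m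
  set b := birkhoffAverage ℂ (g + ·) p n 0
  calc ‖f m - f 0‖ = ‖(a - b) + ((f m - a) - (f 0 - b))‖ := by ring_nf
    _ ≤ ‖a - b‖ + (‖f m - a‖ + ‖f 0 - b‖) :=
      (norm_add_le _ _).trans (by gcongr; exact norm_sub_le _ _)
    _ ≤ ‖a - b‖ + ε := by linarith

/-- **Kronecker's theorem**: `m` lies in the closure of the multiples of `g` when every character
trivial at `g` is trivial at `m`. -/
theorem mem_closure_range_nsmul {g m : UnitAddTorus d}
    (hgm : ∀ v : d → ℤ, mFourier v g = 1 → mFourier v m = 1) :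
    m ∈ closure (range fun k : ℕ ↦ k • g) := by
  rw [← closure_range_zsmul_eq_nsmul]
  let S := AddSubgroup.zmultiples g
  let f : C(UnitAddTorus d, ℂ) :=
    ⟨fun x ↦ (‖(x : UnitAddTorus d ⧸ S)‖ : ℂ),
      Complex.continuous_ofReal.comp (continuous_norm.comp continuous_quot_mk)⟩
  have hf (x : UnitAddTorus d) : f (g + x) = f x := by
    have hg : (g : UnitAddTorus d ⧸ S) = 0 :=
      (QuotientAddGroup.eq_zero_iff g).mpr (AddSubgroup.mem_zmultiples g)
    simp [f, hg]
  have h0 : ‖(m : UnitAddTorus d ⧸ S)‖ = 0 := by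
    have := apply_eq_apply_zero_of_invariant hgm hf
    simpa [f] using this
  rw [QuotientAddGroup.norm_mk_eq_zero_iff_mem_closure] at h0
  simpa [S, AddSubgroup.coe_zmultiples] using h0

end UnitAddTorus

lemma exists_toCircle_eq_of_norm_eq_one {ι : Type*} {γ : ι → ℂ} (hγ : ∀ j, ‖γ j‖ = 1) :
    ∃ x : UnitAddTorus ι, ∀ j, (AddCircle.toCircle (x j) : ℂ) = γ j := by
  have (j : ι) : ∃ x : UnitAddCircle, (AddCircle.toCircle x : ℂ) = γ j := by
    let z : Circle := ⟨γ j, mem_sphere_zero_iff_norm.mpr (hγ j)⟩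
    obtain ⟨x, hx⟩ := (AddCircle.homeomorphCircle (T := 1) one_ne_zero).surjective z
    rw [AddCircle.homeomorphCircle_apply] at hx
    exact ⟨x, congrArg Circle.coeHom hx⟩
  exact Classical.skolem.mp this

/-- For `γ ∈ 𝕋^s`, the orbit `{γ^k : k ∈ ℕ}` is contained in `T(γ)` and is
dense in `T(γ)`, where `T(γ)` is the set of `μ ∈ 𝕋^s` satisfying all the
multiplicative relations satisfied by `γ`. -/
theorem stmt_1 (s : ℕ) (hs : 1 ≤ s) (γ : Fin s → ℂ) (hγ : ∀ j, ‖γ j‖ = 1) :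
    ({μ : Fin s → ℂ | ∃ k : ℕ, μ = fun j => γ j ^ k} ⊆
      {μ : Fin s → ℂ | (∀ j, ‖μ j‖ = 1) ∧
        ∀ v : Fin s → ℤ, (∏ j, γ j ^ v j) = 1 → (∏ j, μ j ^ v j) = 1}) ∧
    closure {μ : Fin s → ℂ | ∃ k : ℕ, μ = fun j => γ j ^ k} =
      {μ : Fin s → ℂ | (∀ j, ‖μ j‖ = 1) ∧
        ∀ v : Fin s → ℤ, (∏ j, γ j ^ v j) = 1 → (∏ j, μ j ^ v j) = 1} := by
  have hsub : {μ : Fin s → ℂ | ∃ k : ℕ, μ = fun j => γ j ^ k} ⊆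
      {μ : Fin s → ℂ | (∀ j, ‖μ j‖ = 1) ∧
        ∀ v : Fin s → ℤ, (∏ j, γ j ^ v j) = 1 → (∏ j, μ j ^ v j) = 1} := by
    rintro _ ⟨k, rfl⟩
    refine ⟨fun j ↦ by simp [hγ j], fun v hv ↦ ?_⟩
    have hpow (j : Fin s) : (γ j ^ k) ^ v j = (γ j ^ v j) ^ k := by
      rw [← zpow_natCast, ← zpow_natCast, zpow_comm]
    simp only [hpow, Finset.prod_pow, hv, one_pow]
  refine ⟨hsub, ?_⟩
  obtain ⟨g, hg⟩ := exists_toCircle_eq_of_norm_eq_one hγ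
  have hchar {μ : Fin s → ℂ} {x : UnitAddTorus (Fin s)}
      (hx : ∀ j, (AddCircle.toCircle (x j) : ℂ) = μ j) (v : Fin s → ℤ) :
      UnitAddTorus.mFourier v x = ∏ j, μ j ^ v j := by
    simp [UnitAddTorus.mFourier, fourier_apply, AddCircle.toCircle_zsmul, hx]
  refine Subset.antisymm (fun μ hμ ↦ ?_) ?_
  · have hnorm : ∀ j, ‖μ j‖ = 1 := by
      have hc : IsClosed {μ : Fin s → ℂ | ∀ j, ‖μ j‖ = 1} := by
        simp only [ofPred_forall]
        exact isClosed_iInter fun j ↦ isClosed_eq (by fun_prop) continuous_const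
      exact closure_minimal (fun ν hν ↦ (hsub hν).1) hc hμ
    refine ⟨hnorm, fun v hv ↦ ?_⟩
    have hcont : ContinuousAt (fun ν : Fin s → ℂ ↦ ∏ j, ν j ^ v j) μ := by
      refine tendsto_finsetProd _ fun j _ ↦ ?_
      exact (continuousAt_apply j μ).zpow₀ (v j) (Or.inl fun h ↦ by simpa [h] using hnorm j)
    have hmaps : MapsTo (fun ν : Fin s → ℂ ↦ ∏ j, ν j ^ v j)
        {μ : Fin s → ℂ | ∃ k : ℕ, μ = fun j => γ j ^ k} {1} := fun ν hν ↦ (hsub hν).2 v hv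
    simpa using hcont.continuousWithinAt.mem_closure hμ hmaps
  · rintro μ ⟨hμ, hrel⟩
    obtain ⟨m, hm⟩ := exists_toCircle_eq_of_norm_eq_one hμ
    have hmem : m ∈ closure (range fun k : ℕ ↦ k • g) :=
      UnitAddTorus.mem_closure_range_nsmul fun v hv ↦ by
        rw [hchar hm]
        exact hrel v (by rwa [hchar hg] at hv)
    have hcont : Continuous fun (x : UnitAddTorus (Fin s)) j ↦ (AddCircle.toCircle (x j) : ℂ) :=
      continuous_pi fun j ↦ continuous_subtype_val.comp
        (AddCircle.continuous_toCircle.comp (continuous_apply j))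
    have hmaps : MapsTo (fun (x : UnitAddTorus (Fin s)) j ↦ (AddCircle.toCircle (x j) : ℂ))
        (range fun k : ℕ ↦ k • g) {μ : Fin s → ℂ | ∃ k : ℕ, μ = fun j => γ j ^ k} := by
      rintro _ ⟨k, rfl⟩
      exact ⟨k, funext fun j ↦ by simp [AddCircle.toCircle_nsmul, hg]⟩
    simpa only [hm] using map_mem_closure hcont hmem hmaps
end

section
/- Let θ, ψ ∈ ℝ^s be such that for every v ∈ ℤ^s, if vᵀθ ∈ ℤ then vᵀψ ∈ ℤ. Then for every ε > 0 there exist p ∈ ℤ^s and a non-negative integer n such that ‖nθ − p − ψ‖_∞ ≤ ε. -/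
open MeasureTheory

namespace UnitAddTorus

variable {d : Type*} [Fintype d]

lemma mFourier_apply_add (n : d → ℤ) (x y : UnitAddTorus d) :
    mFourier n (x + y) = mFourier n x * mFourier n y := by
  simp [mFourier, fourier_apply, AddCircle.toCircle_add, Finset.prod_mul_distrib]

lemma mFourier_coe_eq_exp (n : d → ℤ) (x : d → ℝ) :
    mFourier n (fun j ↦ (x j : UnitAddCircle)) =
      Complex.exp ((∑ j, (n j : ℝ) * x j : ℝ) * (2 * Real.pi * Complex.I)) := by
  simp only [mFourier, ContinuousMap.coe_mk, fourier_coe_apply, ← Complex.exp_sum]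
  push_cast
  rw [Finset.sum_mul]
  congr 1
  refine Finset.sum_congr rfl fun j _ ↦ ?_
  ring

lemma mFourier_coe_eq_one_iff (n : d → ℤ) (x : d → ℝ) :
    mFourier n (fun j ↦ (x j : UnitAddCircle)) = 1 ↔
      ∃ m : ℤ, ∑ j, (n j : ℝ) * x j = (m : ℝ) := by
  rw [mFourier_coe_eq_exp, Complex.exp_eq_one_iff]
  refine exists_congr fun m ↦ ?_
  rw [mul_left_inj' Complex.two_pi_I_ne_zero]
  norm_cast

/-- Integration of a continuous function over the translate by `y` of a subgroup. -/
noncomputable def translateIntegral (H : AddSubgroup (UnitAddTorus d)) (μ : Measure H)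
    [IsProbabilityMeasure μ] [CompactSpace H] (y : UnitAddTorus d) :
    C(UnitAddTorus d, ℂ) →L[ℂ] ℂ :=
  LinearMap.mkContinuous
    { toFun := fun f ↦ ∫ h : H, f (y + h) ∂μ
      map_add' := fun f g ↦ integral_add
        ((by fun_prop : Continuous fun h : H ↦ f (y + h)).integrable_of_hasCompactSupport
          (HasCompactSupport.of_compactSpace _))
        ((by fun_prop : Continuous fun h : H ↦ g (y + h)).integrable_of_hasCompactSupport
          (HasCompactSupport.of_compactSpace _))
      map_smul' := fun c f ↦ integral_const_mul c _ } 1 fun f ↦ by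
    simpa using! norm_integral_le_of_norm_le_const (μ := μ)
      (.of_forall fun h : H ↦ f.norm_coe_le_norm (y + h))

lemma translateIntegral_apply (H : AddSubgroup (UnitAddTorus d)) (μ : Measure H)
    [IsProbabilityMeasure μ] [CompactSpace H] (y : UnitAddTorus d) (f : C(UnitAddTorus d, ℂ)) :
    translateIntegral H μ y f = ∫ h : H, f (y + h) ∂μ := rfl

/-- The integral of a nontrivial character against an invariant measure vanishes. -/
lemma integral_mFourier_eq_zero (H : AddSubgroup (UnitAddTorus d)) (μ : Measure H)
    [μ.IsAddLeftInvariant] {n : d → ℤ} {k : H} (hk : mFourier n (k : UnitAddTorus d) ≠ 1) :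
    ∫ h : H, mFourier n (h : UnitAddTorus d) ∂μ = 0 := by
  have key := integral_add_left_eq_self (μ := μ)
    (fun h : H ↦ mFourier n (h : UnitAddTorus d)) k
  simp only [AddSubgroup.coe_add, mFourier_apply_add, integral_const_mul] at key
  by_contra h0
  exact hk ((mul_eq_right₀ h0).mp key)

/-- Characters separate closed subgroups of the torus from points outside them. -/
theorem mem_of_forall_mFourier_eq_one {H : AddSubgroup (UnitAddTorus d)}
    (hH : IsClosed (H : Set (UnitAddTorus d))) {y : UnitAddTorus d}
    (hy : ∀ n, (∀ h ∈ H, mFourier n h = 1) → mFourier n y = 1) : y ∈ H := by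
  have : CompactSpace H := isCompact_iff_compactSpace.mp hH.isCompact
  let K : TopologicalSpace.PositiveCompacts H := ⊤
  let μ : Measure H := Measure.addHaarMeasure K
  have : IsProbabilityMeasure μ := ⟨Measure.addHaarMeasure_self (K₀ := K)⟩
  have heq : translateIntegral H μ y = translateIntegral H μ 0 := by
    refine ContinuousLinearMap.ext_on
      ((Submodule.dense_iff_topologicalClosure_eq_top).mpr span_mFourier_closure_eq_top) ?_
    rintro _ ⟨n, rfl⟩
    simp only [translateIntegral_apply, zero_add, mFourier_apply_add, integral_const_mul]
    by_cases hn : ∀ h ∈ H, mFourier n h = 1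
    · rw [hy n hn, one_mul]
    · push Not at hn
      obtain ⟨k, hkH, hk⟩ := hn
      rw [integral_mFourier_eq_zero H μ (k := ⟨k, hkH⟩) hk, mul_zero]
  have hint := DFunLike.congr_fun heq
    ⟨fun x ↦ ((Metric.infDist x (H : Set (UnitAddTorus d)) : ℝ) : ℂ),
      Complex.continuous_ofReal.comp (Metric.continuous_infDist_pt _)⟩
  simp only [translateIntegral_apply, ContinuousMap.coe_mk, zero_add, integral_complex_ofReal,
    Metric.infDist_zero_of_mem (SetLike.coe_mem _), integral_zero, Complex.ofReal_zero,
    Complex.ofReal_eq_zero] at hint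
  have hcont : Continuous fun h : H ↦ Metric.infDist (y + h) (H : Set (UnitAddTorus d)) :=
    (Metric.continuous_infDist_pt _).comp (by fun_prop)
  have hzero := (hcont.integral_pos_of_hasCompactSupport_nonneg_nonzero (μ := μ) (x := 0)
    (HasCompactSupport.of_compactSpace _) fun _ ↦ Metric.infDist_nonneg).mt hint.not_gt
  rw [not_not, AddSubgroup.coe_zero, add_zero] at hzero
  exact (hH.mem_iff_infDist_zero ⟨0, H.zero_mem⟩).mpr hzero

end UnitAddTorus

/-- Kronecker's theorem on simultaneous Diophantine approximation: if every
integer relation `vᵀθ ∈ ℤ` implies `vᵀψ ∈ ℤ`, then for every `ε > 0` there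
are `p ∈ ℤ^s` and `n ∈ ℕ` with `‖nθ − p − ψ‖_∞ ≤ ε`. -/
theorem stmt_2 (s : ℕ) (hs : 1 ≤ s) (θ ψ : Fin s → ℝ)
    (h : ∀ v : Fin s → ℤ, (∃ m : ℤ, ∑ j, (v j : ℝ) * θ j = (m : ℝ)) →
      ∃ m : ℤ, ∑ j, (v j : ℝ) * ψ j = (m : ℝ))
    (ε : ℝ) (hε : 0 < ε) :
    ∃ (p : Fin s → ℤ) (n : ℕ), ∀ j, |(n : ℝ) * θ j - (p j : ℝ) - ψ j| ≤ ε := by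
  let x : UnitAddTorus (Fin s) := fun j ↦ (θ j : UnitAddCircle)
  let y : UnitAddTorus (Fin s) := fun j ↦ (ψ j : UnitAddCircle)
  have hy : y ∈ (AddSubgroup.zmultiples x).topologicalClosure :=
    UnitAddTorus.mem_of_forall_mFourier_eq_one
      (AddSubgroup.isClosed_topologicalClosure _) fun n hn ↦
      (UnitAddTorus.mFourier_coe_eq_one_iff n ψ).mpr <| h n <|
        (UnitAddTorus.mFourier_coe_eq_one_iff n θ).mp <| hn x <|
          AddSubgroup.le_topologicalClosure _ (AddSubgroup.mem_zmultiples x)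
  have hy' : y ∈ closure (Set.range (· • x : ℕ → UnitAddTorus (Fin s))) := by
    rw [← closure_range_zsmul_eq_nsmul]
    exact hy
  obtain ⟨_, ⟨n, rfl⟩, hn⟩ := Metric.mem_closure_iff.mp hy' ε hε
  refine ⟨fun j ↦ round (n * θ j - ψ j), n, fun j ↦ ?_⟩
  have hj := (dist_le_pi_dist y (n • x) j).trans hn.le
  have hcoe : n • x j - y j = ((n * θ j - ψ j : ℝ) : UnitAddCircle) := by
    simp [x, y]
  rw [dist_comm, dist_eq_norm, Pi.smul_apply, hcoe, UnitAddCircle.norm_eq] at hj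
  rwa [sub_right_comm]
end

section
/- Let V be the affine hull of {f^n(z_*) : n ≥ d} and let V_0 ⊆ ℝ^d be the unique translate of V through the origin (its direction subspace). Then for every non-zero integer vector v ∈ V_0 ∩ ℤ^d, the set {|vᵀ f^n(z_*)| : n ≥ d} ⊆ ℝ is unbounded. -/
open Polynomial Matrix in
/-- The functional `q ↦ vᵀ q(A) y` on polynomials. -/
noncomputable def orbitFunctional {ι K : Type*} [Fintype ι] [DecidableEq ι] [CommRing K]
    (A : Matrix ι ι K) (v y : ι → K) : K[X] →ₗ[K] K where
  toFun q := v ⬝ᵥ (aeval A q *ᵥ y)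
  map_add' p q := by simp [add_mulVec]
  map_smul' c q := by simp [smul_mulVec]

open Polynomial Matrix in
theorem orbitFunctional_charpoly_mul {ι K : Type*} [Fintype ι] [DecidableEq ι] [CommRing K]
    (A : Matrix ι ι K) (v y : ι → K) (q : K[X]) :
    orbitFunctional A v y (A.charpoly * q) = 0 := by
  simp [orbitFunctional, aeval_self_charpoly]

open Polynomial Matrix in
theorem orbitFunctional_X_pow {ι K : Type*} [Fintype ι] [DecidableEq ι] [CommRing K]
    (A : Matrix ι ι K) (v y : ι → K) (n : ℕ) :
    orbitFunctional A v y (X ^ n) = v ⬝ᵥ ((A ^ n) *ᵥ y) := by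
  simp [orbitFunctional]

open Polynomial Matrix in
/-- A polynomial whose first `d` shifts are annihilated by `orbitFunctional` has all its
multiples annihilated. -/
theorem orbitFunctional_mul_eq_zero {d : ℕ} {K : Type*} [Field K]
    (A : Matrix (Fin d) (Fin d) K) (v y : Fin d → K) (g : K[X])
    (hg : ∀ i < d, orbitFunctional A v y (g * X ^ i) = 0) (q : K[X]) :
    orbitFunctional A v y (g * q) = 0 := by
  have hdeg : (q %ₘ A.charpoly).degree < d := by
    have := degree_modByMonic_lt q A.charpoly_monic
    rwa [charpoly_degree_eq_dim, Fintype.card_fin] at this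
  rw [← modByMonic_add_div q A.charpoly, mul_add, map_add, mul_left_comm,
    orbitFunctional_charpoly_mul, add_zero]
  rw [as_sum_support (q %ₘ A.charpoly), Finset.mul_sum, map_sum]
  refine Finset.sum_eq_zero fun i hi => ?_
  rw [← C_mul_X_pow_eq_monomial, mul_left_comm, ← smul_eq_C_mul, map_smul,
    hg i (by exact_mod_cast (le_degree_of_mem_supp i hi).trans_lt hdeg), smul_zero]

/-- A bounded integer sequence has two equal windows of any prescribed length. -/
theorem exists_equal_windows (u : ℕ → ℤ) (d : ℕ) (C : ℤ) (hC : ∀ n, d ≤ n → |u n| ≤ C) :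
    ∃ m p : ℕ, 1 ≤ p ∧ ∀ i < d, u (m + i + p) = u (m + i) := by
  have hmaps : ∀ n, (fun i : Fin d => u (d + n + i)) ∈
      Set.pi Set.univ fun _ : Fin d => Set.Icc (-C) C := fun n i _ =>
    abs_le.mp (hC _ (by omega))
  obtain ⟨m, -, n, -, hmn, h⟩ := Set.infinite_univ.exists_lt_map_eq_of_mapsTo
    (fun n _ => hmaps n) (Set.Finite.pi fun _ => Set.finite_Icc (-C) C)
  refine ⟨d + m, n - m, by omega, fun i hi => ?_⟩
  have := congrFun h ⟨i, hi⟩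
  simp only at this
  rw [this]
  congr 1
  omega

open Polynomial in
theorem isCoprime_of_no_common_root {p q : ℂ[X]} (hp : p ≠ 0)
    (h : ∀ z, p.IsRoot z → ¬ q.IsRoot z) : IsCoprime p q := by
  refine EuclideanDomain.isCoprime_of_dvd (fun h0 => hp h0.1) fun z hz _ hzp hzq => ?_
  obtain ⟨x, hx⟩ := IsAlgClosed.exists_root z
    (fun h0 => hz (isUnit_iff_degree_eq_zero.mpr h0))
  exact h x (hx.dvd hzp) (hx.dvd hzq)

open Polynomial Matrix in
/-- If `1` is the only root of unity among the eigenvalues of `A` and the increments of the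
integer sequence `u` are `vᵀ A ^ n y`, then boundedness of `u` from index `d` on forces it to be
constant from there on. -/
theorem eventually_const_of_bounded {d : ℕ} (A : Matrix (Fin d) (Fin d) ℤ)
    (hA : ∀ z : ℂ, (A.map (Int.cast : ℤ → ℂ)).charpoly.IsRoot z → ∀ k : ℕ, 1 ≤ k →
      z ^ k = 1 → z = 1)
    (v y : Fin d → ℤ) (u : ℕ → ℤ) (hu : ∀ n, u (n + 1) - u n = v ⬝ᵥ ((A ^ n) *ᵥ y))
    (C : ℤ) (hC : ∀ n, d ≤ n → |u n| ≤ C) (n : ℕ) (hn : d ≤ n) : u (n + 1) = u n := by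
  obtain ⟨m, p, hp, hper⟩ := exists_equal_windows u d C hC
  set B : Matrix (Fin d) (Fin d) ℂ := A.map (Int.cast : ℤ → ℂ) with hB
  set L := orbitFunctional B (fun i => (v i : ℂ)) (fun i => (y i : ℂ)) with hL
  have htel : ∀ j, ∑ l ∈ Finset.range p, (u (j + l + 1) - u (j + l)) = u (j + p) - u j :=
    fun j => Finset.sum_range_sub (fun l => u (j + l)) p
  have hLX : ∀ n, L (X ^ n) = ((u (n + 1) - u n : ℤ) : ℂ) := by
    intro n
    have hpow : B ^ n = (A ^ n).map (Int.cast : ℤ → ℂ) :=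
      (map_pow (Int.castRingHom ℂ).mapMatrix A n).symm
    rw [hL, orbitFunctional_X_pow, hpow, hu]
    simp [dotProduct, mulVec]
  set E : ℂ[X] := ∑ i ∈ Finset.range p, X ^ i with hE
  have hLE : ∀ q, L (E * X ^ m * q) = 0 := by
    refine orbitFunctional_mul_eq_zero _ _ _ _ fun i hi => ?_
    have : E * X ^ m * X ^ i = ∑ j ∈ Finset.range p, X ^ (m + i + j) := by
      rw [hE, mul_assoc, Finset.sum_mul]
      exact Finset.sum_congr rfl fun j _ => by ring
    rw [← hL, this, map_sum, Finset.sum_congr rfl fun j _ => hLX (m + i + j), ← Int.cast_sum,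
      htel, hper i hi, sub_self, Int.cast_zero]
  have hQ : B.charpoly ≠ 0 := B.charpoly_monic.ne_zero
  obtain ⟨R, hR, hRX⟩ := exists_eq_pow_rootMultiplicity_mul_and_not_dvd B.charpoly hQ 0
  set k := B.charpoly.rootMultiplicity 0 with hk
  rw [C_0, sub_zero] at hR hRX
  have hkd : k ≤ d := by
    have h := natDegree_le_of_dvd ⟨R, hR⟩ hQ
    rwa [natDegree_X_pow, charpoly_natDegree_eq_dim, Fintype.card_fin] at h
  have hcop : IsCoprime R (E * X ^ m) := by
    refine isCoprime_of_no_common_root (by rintro rfl; simp at hRX) fun z hz hzE => ?_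
    have hzQ : B.charpoly.IsRoot z := hz.dvd ⟨X ^ k, by rw [mul_comm]; exact hR⟩
    rw [IsRoot.def, eval_mul, mul_eq_zero] at hzE
    rcases hzE with h | h
    · have hzp : z ^ p = 1 := by
        have := mul_geom_sum z p
        rw [hE, eval_finsetSum] at h
        simp only [eval_pow, eval_X] at h
        rw [h, mul_zero] at this
        exact sub_eq_zero.mp this.symm
      rw [hA z hzQ p hp hzp, hE, eval_finsetSum] at h
      simp at h
      omega
    · have hz0 : z = 0 := by
        simp only [eval_pow, eval_X] at h
        exact eq_zero_of_pow_eq_zero h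
      subst hz0
      exact hRX (by rw [X_dvd_iff, coeff_zero_eq_eval_zero]; exact hz)
  obtain ⟨s, t, hst⟩ := hcop
  have hXn : (X : ℂ[X]) ^ n = B.charpoly * (s * X ^ (n - k)) + E * X ^ m * (t * X ^ n) := by
    have : (X : ℂ[X]) ^ n = X ^ k * X ^ (n - k) := by rw [← pow_add]; congr 1; omega
    calc (X : ℂ[X]) ^ n = (s * R + t * (E * X ^ m)) * X ^ n := by rw [hst, one_mul]
      _ = (X ^ k * R) * (s * X ^ (n - k)) + E * X ^ m * (t * X ^ n) := by
        rw [add_mul]; nth_rewrite 1 [this]; ring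
      _ = _ := by rw [← hR]
  have h0 := hLX n
  rw [hXn, map_add, hLE, orbitFunctional_charpoly_mul, add_zero] at h0
  have := Int.cast_eq_zero.mp h0.symm
  omega

/-- Let `V₀` be the direction of the affine hull of `{f^n(z_*) : n ≥ d}`
(i.e. its vector span of differences). Then for every non-zero integer
vector `v ∈ V₀`, the set `{|vᵀ f^n(z_*)| : n ≥ d}` is unbounded. -/
theorem stmt_12 (d : ℕ) (hd : 1 ≤ d)
    (A : Matrix (Fin d) (Fin d) ℤ) (a : Fin d → ℤ)
    (f : (Fin d → ℝ) → (Fin d → ℝ))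
    (hf : ∀ x, f x = (A.map (Int.cast : ℤ → ℝ)).mulVec x + fun i => (a i : ℝ))
    (M : Matrix (Fin d ⊕ Unit) (Fin d ⊕ Unit) ℤ)
    (hM : M = Matrix.fromBlocks A (Matrix.of fun i (_ : Unit) => a i) 0 1)
    (hnondeg : ∀ z w : ℂ, (M.map (Int.cast : ℤ → ℂ)).charpoly.IsRoot z →
      (M.map (Int.cast : ℤ → ℂ)).charpoly.IsRoot w → z ≠ w →
      ¬ ∃ k : ℕ, 1 ≤ k ∧ (z / w) ^ k = 1)
    (zstar : Fin d → ℤ)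
    (v : Fin d → ℤ) (hv0 : (fun i => (v i : ℝ)) ≠ (0 : Fin d → ℝ))
    (hvV : (fun i => (v i : ℝ)) ∈
      vectorSpan ℝ {x : Fin d → ℝ | ∃ n : ℕ, d ≤ n ∧ x = f^[n] (fun i => (zstar i : ℝ))}) :
    ¬ BddAbove {r : ℝ | ∃ n : ℕ, d ≤ n ∧
      r = |∑ i, (v i : ℝ) * (f^[n] (fun i => (zstar i : ℝ))) i|} := by
  classical
  let F : (Fin d → ℤ) → (Fin d → ℤ) := fun x => A.mulVec x + a
  have hcast : ∀ n, f^[n] (fun i => (zstar i : ℝ)) = fun i => ((F^[n] zstar i : ℤ) : ℝ) := by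
    intro n
    induction n with
    | zero => rfl
    | succ n ih =>
      rw [Function.iterate_succ_apply', Function.iterate_succ_apply', ih, hf]
      ext i
      simp [F, Matrix.mulVec, dotProduct]
  let u : ℕ → ℤ := fun n => ∑ i, v i * F^[n] zstar i
  have hdiff : ∀ n, F^[n + 1] zstar - F^[n] zstar = (A ^ n).mulVec (F zstar - zstar) := by
    intro n
    induction n with
    | zero => simp
    | succ n ih =>
      rw [pow_succ', ← Matrix.mulVec_mulVec, ← ih, Matrix.mulVec_sub,
        Function.iterate_succ_apply' F (n + 1), Function.iterate_succ_apply' F n]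
      simp [F]
  have hu : ∀ n, u (n + 1) - u n = v ⬝ᵥ ((A ^ n).mulVec (F zstar - zstar)) := by
    intro n
    rw [← hdiff, dotProduct_sub]
    rfl
  have huf : ∀ n, ∑ i, (v i : ℝ) * (f^[n] (fun i => (zstar i : ℝ))) i = (u n : ℝ) := by
    intro n
    rw [hcast]
    simp [u]
  have hchar : (M.map (Int.cast : ℤ → ℂ)).charpoly =
      (A.map (Int.cast : ℤ → ℂ)).charpoly * (1 : Matrix Unit Unit ℂ).charpoly := by
    rw [hM, Matrix.fromBlocks_map, Matrix.map_zero _ Int.cast_zero,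
      Matrix.map_one _ Int.cast_zero Int.cast_one, Matrix.charpoly_fromBlocks_zero₂₁]
  have hA : ∀ z : ℂ, (A.map (Int.cast : ℤ → ℂ)).charpoly.IsRoot z → ∀ k : ℕ, 1 ≤ k →
      z ^ k = 1 → z = 1 := by
    intro z hz k hk hzk
    by_contra hne
    refine hnondeg z 1 ?_ ?_ hne ⟨k, hk, by rwa [div_one]⟩
    · exact hz.dvd ⟨_, hchar⟩
    · rw [hchar, Matrix.charpoly_one]
      simp
  rintro ⟨C, hC⟩
  have hbound : ∀ n, d ≤ n → |u n| ≤ ⌊C⌋ := by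
    intro n hn
    rw [Int.le_floor, Int.cast_abs, ← huf]
    exact hC ⟨n, hn, rfl⟩
  have hstep := eventually_const_of_bounded A hA v (F zstar - zstar) u hu ⌊C⌋ hbound
  have hconst : ∀ n, d ≤ n → u n = u d := fun n hn =>
    Nat.le_induction rfl (fun m hm ih => (hstep m hm).trans ih) n hn
  let φ : (Fin d → ℝ) →ₗ[ℝ] ℝ := dotProductBilin ℝ ℝ (fun i => (v i : ℝ))
  have hφ : ∀ x, φ x = (fun i => (v i : ℝ)) ⬝ᵥ x := fun _ => rfl
  have hker : vectorSpan ℝ {x : Fin d → ℝ | ∃ n : ℕ, d ≤ n ∧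
      x = f^[n] (fun i => (zstar i : ℝ))} ≤ LinearMap.ker φ := by
    rw [vectorSpan_def, Submodule.span_le]
    rintro _ ⟨_, ⟨m, hm, rfl⟩, _, ⟨n, hn, rfl⟩, rfl⟩
    have h : ∀ m, d ≤ m → φ (f^[m] (fun i => (zstar i : ℝ))) = (u d : ℝ) := fun m hm => by
      rw [hφ, ← hconst m hm]
      exact huf m
    simp only [vsub_eq_sub, SetLike.mem_coe, LinearMap.mem_ker, map_sub, h m hm, h n hn, sub_self]
  exact hv0 (dotProduct_self_eq_zero.mp (hker hvV))
end

section
/- There exists a positive integer M ≥ d such that for all n ≥ M, the set conv({f^d(z_*), f^{d+1}(z_*), …, f^n(z_*)}) contains a point of ℤ^d in its relative interior. -/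
/-- If every point of `S` is an affine combination of the points `y i ∈ S`, then an affine combination
of the `y i` with positive weights is an intrinsic interior point of the convex hull of `S`. -/
theorem sum_smul_mem_intrinsicInterior_convexHull {ι E : Type*} [Fintype ι]
    [NormedAddCommGroup E] [NormedSpace ℝ E] [FiniteDimensional ℝ E] {S : Set E} {y : ι → E}
    (hy : ∀ i, y i ∈ S) (hS : ∀ s ∈ S, ∃ c : ι → ℝ, ∑ i, c i = 1 ∧ ∑ i, c i • y i = s)
    {w : ι → ℝ} (hw : ∀ i, 0 < w i) (hw1 : ∑ i, w i = 1) :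
    ∑ i, w i • y i ∈ intrinsicInterior ℝ (convexHull ℝ S) := by
  let L : (ι → ℝ) →ₗ[ℝ] E × ℝ := Fintype.linearCombination ℝ fun i => (y i, (1 : ℝ))
  have hL : ∀ c, L c = (∑ i, c i • y i, ∑ i, c i) := fun c => by
    simp [L, Fintype.linearCombination_apply, Prod.ext_iff, Prod.fst_sum, Prod.snd_sum]
  have hopen : IsOpenMap L.rangeRestrict :=
    LinearMap.isOpenMap_of_finiteDimensional _ L.surjective_rangeRestrict
  have hpos : IsOpen {c : ι → ℝ | ∀ i, 0 < c i} := by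
    simp only [Set.ofPred_forall]
    exact isOpen_iInter_of_finite fun i => isOpen_lt continuous_const (continuous_apply i)
  have hspan : ∀ x ∈ affineSpan ℝ (convexHull ℝ S), (x, (1 : ℝ)) ∈ L.range := by
    intro x hx
    rw [affineSpan_convexHull] at hx
    refine affineSpan_induction (p := fun x => (x, (1 : ℝ)) ∈ L.range) hx (fun s hs => ?_)
      fun c u v z hu hv hz => ?_
    · obtain ⟨c, hc1, hc⟩ := hS s hs
      exact ⟨c, by rw [hL, hc1, hc]⟩
    · have := L.range.add_mem (L.range.smul_mem c (L.range.sub_mem hu hv)) hz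
      simpa using this
  have hconv : ∀ c : ι → ℝ, (∀ i, 0 < c i) → ∑ i, c i = 1 →
      ∑ i, c i • y i ∈ convexHull ℝ S := fun c hc hc1 =>
    (convex_convexHull ℝ S).sum_mem (fun i _ => (hc i).le) hc1
      fun i _ => subset_convexHull ℝ S (hy i)
  rw [mem_intrinsicInterior]
  refine ⟨⟨_, subset_affineSpan ℝ _ (hconv w hw hw1)⟩, ?_, rfl⟩
  rw [mem_interior]
  let φ : affineSpan ℝ (convexHull ℝ S) → L.range := fun x => ⟨(x, 1), hspan x x.2⟩
  have hφ : Continuous φ := by fun_prop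
  refine ⟨φ ⁻¹' (L.rangeRestrict '' {c | ∀ i, 0 < c i}), ?_, (hopen _ hpos).preimage hφ, ?_⟩
  · rintro x ⟨c, hc, hcx⟩
    have := congrArg Subtype.val hcx
    rw [LinearMap.rangeRestrict, LinearMap.codRestrict_apply, hL, Prod.mk.injEq] at this
    rw [Set.mem_preimage, ← this.1]
    exact hconv c hc this.2
  · exact ⟨w, hw, Subtype.ext (by rw [LinearMap.rangeRestrict, LinearMap.codRestrict_apply, hL, hw1])⟩

namespace Polynomial

theorem X_sub_C_pow_dvd_of_dvd_expand {K : Type*} [Field K] [CharZero K] {m n : ℕ} (hm : m ≠ 0)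
    {x : K} (hx : x ≠ 0) {h : K[X]} (hh : h ≠ 0) (hdvd : (X - C x) ^ n ∣ expand K m h) :
    (X - C (x ^ m)) ^ n ∣ h := by
  obtain ⟨g, hg, hng⟩ := exists_eq_pow_rootMultiplicity_mul_and_not_dvd h hh (x ^ m)
  set k := rootMultiplicity (x ^ m) h
  obtain ⟨q, hq⟩ : X - C x ∣ (X ^ m - C (x ^ m) : K[X]) := by simp [dvd_iff_isRoot]
  have hqx : q.eval x ≠ 0 := by
    have h1 := congrArg (fun p => (derivative p).eval x) hq
    simp only [derivative_sub, derivative_X_pow, derivative_C, derivative_mul, derivative_X,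
      eval_sub, eval_mul, eval_add, eval_C, eval_pow, eval_X, eval_one, eval_zero] at h1
    intro h0
    simp [h0, hm, hx] at h1
  have hgx : g.eval (x ^ m) ≠ 0 := fun h0 => hng (dvd_iff_isRoot.2 h0)
  have hexp : expand K m h = (X - C x) ^ k * (q ^ k * expand K m g) := by
    conv_lhs => rw [hg]
    simp only [map_mul, map_pow, map_sub, expand_X, expand_C]
    rw [← C_pow, hq, mul_pow, mul_assoc]
  have hnk : n ≤ k := by
    by_contra! hlt
    have h1 := (pow_dvd_pow (X - C x) hlt).trans hdvd
    rw [hexp, pow_succ, mul_dvd_mul_iff_left (pow_ne_zero _ (X_sub_C_ne_zero x)),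
      dvd_iff_isRoot, IsRoot.def, eval_mul, eval_pow, expand_eval] at h1
    exact mul_ne_zero (pow_ne_zero _ hqx) hgx h1
  exact (pow_dvd_pow _ hnk).trans ⟨g, hg⟩

theorem natDegree_le_of_dvd_expand {K : Type*} [Field K] [CharZero K] [IsAlgClosed K] {m : ℕ}
    (hm : m ≠ 0) {Q h : K[X]} (hQ : Q ≠ 0) (hh : h ≠ 0) (h0 : ∀ z, Q.IsRoot z → z ≠ 0)
    (hinj : ∀ z w, Q.IsRoot z → Q.IsRoot w → z ^ m = w ^ m → z = w)
    (hdvd : Q ∣ expand K m h) : Q.natDegree ≤ h.natDegree := by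
  classical
  have hle : Q.roots.map (· ^ m) ≤ h.roots := by
    rw [Multiset.le_iff_count]
    intro b
    by_cases hb : b ∈ Q.roots.map (· ^ m)
    · obtain ⟨z, hz, rfl⟩ := Multiset.mem_map.1 hb
      have hzr := (mem_roots hQ).1 hz
      have hcount : (Q.roots.map (· ^ m)).count (z ^ m) = Q.roots.count z :=
        Multiset.count_map_eq_count (· ^ m) Q.roots
          (fun a ha b hb => hinj a b ((mem_roots hQ).1 ha) ((mem_roots hQ).1 hb)) z hz
      rw [hcount, count_roots, count_roots, le_rootMultiplicity_iff hh]
      exact X_sub_C_pow_dvd_of_dvd_expand hm (h0 z hzr) hh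
        ((pow_rootMultiplicity_dvd Q z).trans hdvd)
    · rw [Multiset.count_eq_zero_of_notMem hb]
      exact Nat.zero_le _
  calc Q.natDegree = Q.roots.card := (IsAlgClosed.card_roots_eq_natDegree).symm
    _ ≤ h.roots.card := by simpa using Multiset.card_le_card hle
    _ ≤ h.natDegree := card_roots' h

/-- If the complex roots of `Q` are nonzero and have distinct `m`-th powers, then every polynomial is
congruent modulo `Q` to a polynomial in `X ^ m`. -/
theorem exists_dvd_sub_expand {m : ℕ} (hm : m ≠ 0) {Q : ℝ[X]} (hQ : Q ≠ 0)
    (h0 : ∀ z, (Q.map (algebraMap ℝ ℂ)).IsRoot z → z ≠ 0)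
    (hinj : ∀ z w, (Q.map (algebraMap ℝ ℂ)).IsRoot z → (Q.map (algebraMap ℝ ℂ)).IsRoot w →
      z ^ m = w ^ m → z = w) (s : ℝ[X]) :
    ∃ g : ℝ[X], Q ∣ s - expand ℝ m g := by
  let φ : degreeLT ℝ Q.natDegree →ₗ[ℝ] AdjoinRoot Q :=
    (AdjoinRoot.mkₐ Q).toLinearMap ∘ₗ (expand ℝ m).toLinearMap ∘ₗ (degreeLT ℝ Q.natDegree).subtype
  have hφ : ∀ g, φ g = AdjoinRoot.mk Q (expand ℝ m g) := fun g => rfl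
  have : FiniteDimensional ℝ (AdjoinRoot Q) := (AdjoinRoot.powerBasis hQ).finite
  have : FiniteDimensional ℝ (degreeLT ℝ Q.natDegree) :=
    (degreeLTEquiv ℝ Q.natDegree).symm.finiteDimensional
  have hfin : Module.finrank ℝ (degreeLT ℝ Q.natDegree) = Module.finrank ℝ (AdjoinRoot Q) := by
    rw [(degreeLTEquiv ℝ Q.natDegree).finrank_eq, (AdjoinRoot.powerBasis hQ).finrank]
    simp
  have hφinj : Function.Injective φ := by
    rw [injective_iff_map_eq_zero]
    rintro ⟨g, hg⟩ hg0
    rw [hφ, AdjoinRoot.mk_eq_zero] at hg0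
    by_contra hne
    have hne : g ≠ 0 := fun h => hne (by simp [h])
    have hle := natDegree_le_of_dvd_expand hm
      ((Polynomial.map_ne_zero_iff (algebraMap ℝ ℂ).injective).2 hQ)
      ((Polynomial.map_ne_zero_iff (algebraMap ℝ ℂ).injective).2 hne) h0 hinj
      (by rw [← map_expand]; exact Polynomial.map_dvd _ hg0)
    rw [natDegree_map, natDegree_map] at hle
    rw [mem_degreeLT, degree_eq_natDegree hne] at hg
    exact absurd hle (by exact_mod_cast hg.not_ge)
  obtain ⟨g, hg⟩ := (LinearMap.injective_iff_surjective_of_finrank_eq_finrank hfin).1 hφinj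
    (AdjoinRoot.mk Q s)
  refine ⟨g, ?_⟩
  rw [← AdjoinRoot.mk_eq_zero, map_sub, ← hg, hφ, sub_self]

end Polynomial

open Polynomial in
/-- Let `X ^ e * Q` be the characteristic polynomial of `B`, where the complex roots of `Q` are nonzero
and have distinct `m`-th powers. Then beyond the exponent `e` all powers of `B` are combinations of
powers whose exponents form an arithmetic progression with difference `m`. -/
theorem Matrix.exists_pow_eq_sum_pow {n : Type*} [Fintype n] [DecidableEq n] {N : ℕ}
    (hN : Fintype.card n ≤ N) (B : Matrix n n ℝ) {Q : ℝ[X]} {e : ℕ} (hB : B.charpoly = X ^ e * Q)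
    {m : ℕ} (hm : m ≠ 0) (h0 : ∀ z, (Q.map (algebraMap ℝ ℂ)).IsRoot z → z ≠ 0)
    (hinj : ∀ z w, (Q.map (algebraMap ℝ ℂ)).IsRoot z → (Q.map (algebraMap ℝ ℂ)).IsRoot w →
      z ^ m = w ^ m → z = w) {j k : ℕ} (hj : e ≤ j) (hk : e ≤ k) :
    ∃ c : Fin N → ℝ, B ^ j = ∑ i, c i • B ^ (k + i * m) := by
  have hQ : Q ≠ 0 := right_ne_zero_of_mul (hB ▸ B.charpoly_monic.ne_zero)
  have hcop : IsCoprime Q (X ^ (k - e)) := by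
    refine IsCoprime.pow_right (((irreducible_X.coprime_iff_not_dvd).2 fun hdvd => ?_).symm)
    refine h0 0 ?_ rfl
    rw [X_dvd_iff, coeff_zero_eq_eval_zero] at hdvd
    rw [IsRoot.def, ← map_zero (algebraMap ℝ ℂ), eval_map_algebraMap, aeval_algebraMap_apply,
      coe_aeval_eq_eval, hdvd, map_zero]
  obtain ⟨u, v, huv⟩ := hcop
  obtain ⟨g, q, hg⟩ := exists_dvd_sub_expand hm hQ h0 hinj (X ^ (j - e) * v)
  let r := g %ₘ (B ^ m).charpoly
  have hpoly : (X ^ j : ℝ[X]) = X ^ k * expand ℝ m g +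
      B.charpoly * (X ^ (j - e) * u + X ^ (k - e) * q) := by
    obtain ⟨j, rfl⟩ := Nat.exists_eq_add_of_le hj
    obtain ⟨k, rfl⟩ := Nat.exists_eq_add_of_le hk
    simp only [Nat.add_sub_cancel_left] at huv hg ⊢
    rw [hB]
    linear_combination (-(X ^ (e + j) : ℝ[X])) * huv + X ^ (e + k) * hg
  have hr : r.natDegree < N ∨ r = 0 := by
    by_cases hr0 : r = 0
    · exact Or.inr hr0
    have hd := degree_modByMonic_lt g (B ^ m).charpoly_monic
    rw [Matrix.charpoly_degree_eq_dim] at hd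
    exact Or.inl (((natDegree_lt_iff_degree_lt hr0).2 hd).trans_le hN)
  have hBr : aeval (B ^ m) r = ∑ i : Fin N, r.coeff i • (B ^ m) ^ (i : ℕ) := by
    rcases hr with hr | hr
    · rw [aeval_eq_sum_range' hr, Finset.sum_range]
    · simp [hr]
  refine ⟨fun i => r.coeff i, ?_⟩
  have := congrArg (aeval B) hpoly
  rw [map_add, map_mul, map_mul, Matrix.aeval_self_charpoly, zero_mul, add_zero, expand_aeval,
    ← aeval_modByMonic_eq_self_of_root (Matrix.aeval_self_charpoly (B ^ m)), hBr] at this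
  simp only [map_pow, aeval_X] at this
  rw [this, Finset.mul_sum]
  refine Finset.sum_congr rfl fun i _ => ?_
  rw [mul_smul_comm, pow_add, ← pow_mul, mul_comm m]

/-- The orbit of a self-map of a finite type becomes periodic, past any prescribed time. -/
theorem Function.exists_iterate_add_mul_eq {α : Type*} [Finite α] (F : α → α) (x : α) (t : ℕ) :
    ∃ k m : ℕ, t ≤ k ∧ m ≠ 0 ∧ ∀ i, F^[k + i * m] x = F^[k] x := by
  obtain ⟨a, b, hab, h⟩ := Finite.exists_ne_map_eq_of_infinite fun n => F^[t + n] x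
  wlog hlt : a < b generalizing a b
  · exact this b a hab.symm h.symm (by omega)
  refine ⟨t + a, b - a, by omega, by omega, fun i => ?_⟩
  induction i with
  | zero => simp
  | succ i ih =>
    have h1 : t + a + (i + 1) * (b - a) = i * (b - a) + (t + b) := by
      rw [add_mul, one_mul]; omega
    rw [h1, Function.iterate_add_apply, ← h, ← Function.iterate_add_apply, add_comm (i * (b - a)), ih]

/-- An affine map iterates as a power of its augmented matrix. -/
theorem Matrix.fromBlocks_pow_mulVec_sumElim {n R : Type*} [Fintype n] [DecidableEq n] [CommRing R]
    (A : Matrix n n R) (a : n → R) (x : n → R) (k : ℕ) :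
    ((Matrix.fromBlocks A (Matrix.of fun i (_ : Unit) => a i) 0 1 :
      Matrix (n ⊕ Unit) (n ⊕ Unit) R) ^ k).mulVec
      (Sum.elim x fun _ => 1) = Sum.elim ((fun x => A.mulVec x + a)^[k] x) fun _ => 1 := by
  induction k with
  | zero => simp
  | succ k ih =>
    rw [pow_succ', ← Matrix.mulVec_mulVec, ih, Function.iterate_succ_apply', Matrix.fromBlocks_mulVec]
    congr 1
    · ext i; simp [Matrix.mulVec, dotProduct]
    · ext i; simp

/-- There exists `M ≥ d` such that for all `n ≥ M` the convex hull of
`{f^d(z_*), f^{d+1}(z_*), …, f^n(z_*)}` contains an integer point in its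
relative (intrinsic) interior. -/
theorem stmt_13 (d : ℕ) (hd : 1 ≤ d)
    (A : Matrix (Fin d) (Fin d) ℤ) (a : Fin d → ℤ)
    (f : (Fin d → ℝ) → (Fin d → ℝ))
    (hf : ∀ x, f x = (A.map (Int.cast : ℤ → ℝ)).mulVec x + fun i => (a i : ℝ))
    (M : Matrix (Fin d ⊕ Unit) (Fin d ⊕ Unit) ℤ)
    (hM : M = Matrix.fromBlocks A (Matrix.of fun i (_ : Unit) => a i) 0 1)
    (hnondeg : ∀ z w : ℂ, (M.map (Int.cast : ℤ → ℂ)).charpoly.IsRoot z →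
      (M.map (Int.cast : ℤ → ℂ)).charpoly.IsRoot w → z ≠ w →
      ¬ ∃ k : ℕ, 1 ≤ k ∧ (z / w) ^ k = 1)
    (zstar : Fin d → ℤ) :
    ∃ M₀ : ℕ, d ≤ M₀ ∧ ∀ n : ℕ, M₀ ≤ n →
      ∃ p : Fin d → ℤ, (fun i => (p i : ℝ)) ∈ intrinsicInterior ℝ
        (convexHull ℝ ((fun k => f^[k] (fun i => (zstar i : ℝ))) '' Set.Icc d n)) := by
  classical
  have hP : (M.map (Int.cast : ℤ → ℂ)).charpoly =
      ((M.map (Int.cast : ℤ → ℝ)).charpoly).map (algebraMap ℝ ℂ) := by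
    rw [← Matrix.charpoly_map, Matrix.map_map]
    congr 2
  let Aℝ := A.map (Int.cast : ℤ → ℝ)
  have hMℝ : M.map (Int.cast : ℤ → ℝ) =
      Matrix.fromBlocks Aℝ (Matrix.of fun i (_ : Unit) => (a i : ℝ)) 0 1 := by
    rw [hM, Matrix.fromBlocks_map]
    congr 1
    · ext; simp
    · exact Matrix.map_one _ Int.cast_zero Int.cast_one
  have hfF : f = fun x => Aℝ.mulVec x + fun i => (a i : ℝ) := funext hf
  obtain ⟨Q₀, hQ₀, hQ₀X⟩ := Polynomial.exists_eq_pow_rootMultiplicity_mul_and_not_dvd Aℝ.charpoly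
    Aℝ.charpoly_monic.ne_zero 0
  rw [map_zero, sub_zero] at hQ₀ hQ₀X
  set e := Aℝ.charpoly.rootMultiplicity 0
  have hed : e ≤ d := by
    have h1 : Aℝ.charpoly.natDegree = d := by simp [Aℝ.charpoly_natDegree_eq_dim]
    exact h1 ▸ by
      change Aℝ.charpoly.rootMultiplicity 0 ≤ _
      rw [← Polynomial.count_roots]
      exact (Multiset.count_le_card _ _).trans (Polynomial.card_roots' _)
  let Q : Polynomial ℝ := Q₀ * (1 : Matrix Unit Unit ℝ).charpoly
  have hQ : (M.map (Int.cast : ℤ → ℝ)).charpoly = Polynomial.X ^ e * Q := by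
    rw [hMℝ, Matrix.charpoly_fromBlocks_zero₂₁, hQ₀, mul_assoc]
  have hroot : ∀ z, (Q.map (algebraMap ℝ ℂ)).IsRoot z →
      (M.map (Int.cast : ℤ → ℂ)).charpoly.IsRoot z := fun z hz => by
    rw [hP, hQ, Polynomial.map_mul]
    exact Polynomial.root_mul_left_of_isRoot _ hz
  have hne0 : ∀ z, (Q.map (algebraMap ℝ ℂ)).IsRoot z → z ≠ 0 := by
    rintro z hz rfl
    rw [Polynomial.IsRoot.def, ← map_zero (algebraMap ℝ ℂ), Polynomial.eval_map_algebraMap,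
      Polynomial.aeval_algebraMap_apply, Polynomial.coe_aeval_eq_eval] at hz
    replace hz := (algebraMap ℝ ℂ).injective hz
    rw [Polynomial.eval_mul, mul_eq_zero] at hz
    rcases hz with hz | hz
    · exact hQ₀X (by rwa [Polynomial.X_dvd_iff, Polynomial.coeff_zero_eq_eval_zero])
    · simp [Matrix.charpoly_one] at hz
  have hinj : ∀ m : ℕ, m ≠ 0 → ∀ z w, (Q.map (algebraMap ℝ ℂ)).IsRoot z →
      (Q.map (algebraMap ℝ ℂ)).IsRoot w → z ^ m = w ^ m → z = w := by
    intro m hm z w hz hw hzw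
    by_contra hne
    refine hnondeg z w (hroot z hz) (hroot w hw) hne ⟨m, Nat.one_le_iff_ne_zero.2 hm, ?_⟩
    rw [div_pow, hzw, div_self (pow_ne_zero _ (hne0 w hw))]
  -- the orbit is integral and eventually periodic modulo `d + 1`
  let g : (Fin d → ℤ) → (Fin d → ℤ) := fun x => A.mulVec x + a
  have hgf : ∀ k, f^[k] (fun i => (zstar i : ℝ)) = fun i => (((g^[k] zstar) i : ℤ) : ℝ) := by
    intro k
    refine (Function.Semiconj.iterate_right (f := fun (x : Fin d → ℤ) i => (x i : ℝ)) (ga := g)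
      (gb := f) (fun x => ?_) k zstar).symm
    ext i
    simp [hf, g, Matrix.mulVec, dotProduct]
  let F : (Fin d → ZMod (d + 1)) → (Fin d → ZMod (d + 1)) := fun x =>
    (A.map (Int.cast : ℤ → ZMod (d + 1))).mulVec x + fun i => (a i : ZMod (d + 1))
  have hgF : ∀ k, F^[k] (fun i => (zstar i : ZMod (d + 1))) =
      fun i => (((g^[k] zstar) i : ℤ) : ZMod (d + 1)) := by
    intro k
    refine (Function.Semiconj.iterate_right (f := fun (x : Fin d → ℤ) i => (x i : ZMod (d + 1)))
      (ga := g) (gb := F) (fun x => ?_) k zstar).symm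
    ext i
    simp [F, g, Matrix.mulVec, dotProduct]
  obtain ⟨k, m, hdk, hm, hper⟩ :=
    Function.exists_iterate_add_mul_eq F (fun i => (zstar i : ZMod (d + 1))) d
  have hdvd : ∀ l : Fin d, ((d + 1 : ℕ) : ℤ) ∣ ∑ i : Fin (d + 1), (g^[k + i * m] zstar) l := by
    intro l
    rw [← ZMod.intCast_zmod_eq_zero_iff_dvd, Int.cast_sum]
    have h1 : ∀ i : Fin (d + 1), (((g^[k + i * m] zstar) l : ℤ) : ZMod (d + 1)) =
        (((g^[k] zstar) l : ℤ) : ZMod (d + 1)) := fun i => by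
      have := congrFun (hper i) l
      rwa [hgF, hgF] at this
    simp only [h1, Finset.sum_const, Finset.card_univ, Fintype.card_fin, nsmul_eq_mul,
      ZMod.natCast_self, zero_mul]
  choose p hp using hdvd
  refine ⟨k + d * m, by omega, fun n hn => ⟨p, ?_⟩⟩
  have hcomb : (fun i => (p i : ℝ)) = ∑ i : Fin (d + 1), ((d : ℝ) + 1)⁻¹ •
      f^[k + i * m] (fun i => (zstar i : ℝ)) := by
    ext l
    have h1 := congrArg (Int.cast : ℤ → ℝ) (hp l)
    push_cast at h1
    simp only [hgf, Finset.sum_apply, Pi.smul_apply, smul_eq_mul, ← Finset.mul_sum, h1]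
    field_simp
  rw [hcomb]
  refine sum_smul_mem_intrinsicInterior_convexHull (fun i => ?_) ?_ (fun i => by positivity) ?_
  · refine ⟨k + i * m, ⟨by omega, ?_⟩, rfl⟩
    have : (i : ℕ) * m ≤ d * m := Nat.mul_le_mul_right _ (by omega)
    omega
  · rintro _ ⟨j, hj, rfl⟩
    obtain ⟨c, hc⟩ := Matrix.exists_pow_eq_sum_pow (N := d + 1) (by simp) _ hQ hm hne0 (hinj m hm)
      (hed.trans hj.1) (hed.trans hdk)
    have h1 := congrArg (fun B => B.mulVec (Sum.elim (fun i => (zstar i : ℝ)) fun _ => 1)) hc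
    simp only [Matrix.sum_mulVec, Matrix.smul_mulVec, hMℝ,
      Matrix.fromBlocks_pow_mulVec_sumElim] at h1
    rw [← hfF] at h1
    refine ⟨c, ?_, ?_⟩
    · simpa using (congrFun h1 (Sum.inr ())).symm
    · ext l
      simpa using (congrFun h1 (Sum.inl l)).symm
  · simp only [Finset.sum_const, Finset.card_univ, Fintype.card_fin, nsmul_eq_mul]
    push_cast
    field_simp
end
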